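/- arXiv:2203.02993 — 10 statements merged into one kernel-verified Lean document; each statement's English description precedes it below -/
import Mathlib

section
/- Let a > 0 and r_k ∈ ℝ. Define f(r) = −exp(−a r²) and the quadratic function g(r) = −exp(−a r_k²) + a·exp(−a r_k²)·(r² − r_k²). Then f(r) ≤ g(r) for every r ∈ ℝ, and equality holds at r = r_k and at r = −r_k. -/
open Real

/-- The symmetric quadratic surrogate `g(r) = -exp(-a r_k²) + a exp(-a r_k²)(r² - r_k²)`
majorizes `f(r) = -exp(-a r²)` everywhere, with equality at `r = r_k` and `r = -r_k`. -/
theorem quadratic_majorizes_l2e_term (a rk : ℝ) (ha : 0 < a)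
    (f g : ℝ → ℝ)
    (hf : ∀ r, f r = -Real.exp (-a * r ^ 2))
    (hg : ∀ r, g r = -Real.exp (-a * rk ^ 2) + a * Real.exp (-a * rk ^ 2) * (r ^ 2 - rk ^ 2)) :
    (∀ r, f r ≤ g r) ∧ f rk = g rk ∧ f (-rk) = g (-rk) := by
  refine ⟨fun r => ?_, ?_, ?_⟩
  · rw [hf, hg]
    have h1 := Real.add_one_le_exp (-a * r ^ 2 - -a * rk ^ 2)
    have h2 : Real.exp (-a * r ^ 2)
        = Real.exp (-a * rk ^ 2) * Real.exp (-a * r ^ 2 - -a * rk ^ 2) := by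
      rw [← Real.exp_add]
      congr 1
      ring
    have h3 := mul_le_mul_of_nonneg_left h1 (Real.exp_pos (-a * rk ^ 2)).le
    rw [← h2] at h3
    linarith
  · rw [hf, hg]
    ring
  · rw [hf, hg, neg_sq]
    ring
end

section
/- Let a > 0 and r_k ∈ ℝ with r_k ≠ 0. Define f(r) = −exp(−a r²) and g(r) = −exp(−a r_k²) + a·exp(−a r_k²)·(r² − r_k²). If p(r) = α r² + β r + γ is any quadratic function satisfying p(r) ≥ f(r) for all r ∈ ℝ and p(r_k) = f(r_k), then p(r) ≥ g(r) for all r ∈ ℝ. In other words, g is the sharp (pointwise smallest) quadratic majorizer of f touching f at r_k. -/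
open Real

/-- `g(r) = -exp(-a r_k²) + a exp(-a r_k²)(r² - r_k²)` is the sharp quadratic majorizer
of `f(r) = -exp(-a r²)` touching at `r_k ≠ 0`: every quadratic majorizer `p` of `f`
touching `f` at `r_k` lies above `g` everywhere. -/
theorem sharp_quadratic_majorizer (a rk : ℝ) (ha : 0 < a) (hrk : rk ≠ 0)
    (f g : ℝ → ℝ)
    (hf : ∀ r, f r = -Real.exp (-a * r ^ 2))
    (hg : ∀ r, g r = -Real.exp (-a * rk ^ 2) + a * Real.exp (-a * rk ^ 2) * (r ^ 2 - rk ^ 2))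
    (α β γ : ℝ)
    (hmaj : ∀ r, α * r ^ 2 + β * r + γ ≥ f r)
    (htouch : α * rk ^ 2 + β * rk + γ = f rk) :
    ∀ r, α * r ^ 2 + β * r + γ ≥ g r := by
  have hmin : IsLocalMin (fun r : ℝ => α * r ^ 2 + β * r + γ + Real.exp (-a * r ^ 2)) rk := by
    refine Filter.Eventually.of_forall fun r => ?_
    have h1 := hmaj r
    rw [hf] at h1 htouch
    show α * rk ^ 2 + β * rk + γ + Real.exp (-a * rk ^ 2)
      ≤ α * r ^ 2 + β * r + γ + Real.exp (-a * r ^ 2)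
    linarith
  have hsq : HasDerivAt (fun r : ℝ => r ^ 2) (2 * rk) rk := by
    simpa using hasDerivAt_pow 2 rk
  have hder : HasDerivAt (fun r : ℝ => α * r ^ 2 + β * r + γ + Real.exp (-a * r ^ 2))
      (α * (2 * rk) + β * 1 + Real.exp (-a * rk ^ 2) * (-a * (2 * rk))) rk :=
    (((hsq.const_mul α).add ((hasDerivAt_id rk).const_mul β)).add_const γ).add
      (hsq.const_mul (-a)).exp
  have h0 := hmin.hasDerivAt_eq_zero hder
  have hneg := hmaj (-rk)
  rw [hf, neg_sq] at hneg
  rw [hf] at htouch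
  intro r
  rw [hg]
  generalize Real.exp (-a * rk ^ 2) = E at *
  have hβ : β = -(2 * (α - a * E) * rk) := by linarith
  have hpos : 0 < rk ^ 2 := by positivity
  have hc : 0 ≤ α - a * E := by
    have : 0 ≤ (α - a * E) * rk ^ 2 := by
      have : 0 ≤ -(β * rk) := by linarith
      rw [hβ] at this
      linarith
    exact nonneg_of_mul_nonneg_left this hpos
  have hγ : γ = -E - α * rk ^ 2 - β * rk := by linarith
  have key : 0 ≤ (α - a * E) * (r - rk) ^ 2 := mul_nonneg hc (sq_nonneg _)
  rw [hγ, hβ]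
  linarith
end

section
/- Let f : ℝ → ℝ be differentiable and let a, b be distinct real numbers. Suppose q(r) = α₁ r² + β₁ r + γ₁ is a quadratic function with q(r) ≥ f(r) for all r ∈ ℝ, q(a) = f(a), and q(b) = f(b). Then every quadratic function p(r) = α₂ r² + β₂ r + γ₂ with p(r) ≥ f(r) for all r ∈ ℝ and p(a) = f(a) satisfies p(r) ≥ q(r) for all r ∈ ℝ; that is, a quadratic majorizer of a differentiable function that touches it at two distinct points is the sharp quadratic majorizer at each touching point. -/
theorem touch_deriv_eq (f : ℝ → ℝ) (a α β γ : ℝ) (hf : DifferentiableAt ℝ f a)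
    (h : ∀ r, α * r ^ 2 + β * r + γ ≥ f r) (ha : α * a ^ 2 + β * a + γ = f a) :
    2 * α * a + β = deriv f a := by
  have hd : HasDerivAt (fun r => α * r ^ 2 + β * r + γ - f r)
      (α * (2 * a) + β * 1 - deriv f a) a := by
    have h1 : HasDerivAt (fun r : ℝ => r ^ 2) (2 * a) a := by
      simpa using hasDerivAt_pow 2 a
    exact (((h1.const_mul α).add ((hasDerivAt_id a).const_mul β)).add_const γ).sub hf.hasDerivAt
  have hm : IsLocalMin (fun r => α * r ^ 2 + β * r + γ - f r) a := by
    refine Filter.Eventually.of_forall fun r => ?_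
    have := h r
    show α * a ^ 2 + β * a + γ - f a ≤ α * r ^ 2 + β * r + γ - f r
    linarith
  have := hm.hasDerivAt_eq_zero hd
  linarith

/-- Van Ruitenburg's lemma: a quadratic majorizer `q` of a differentiable function `f`
that touches `f` at two distinct points `a ≠ b` is the sharp quadratic majorizer of `f`
at each touching point: every quadratic majorizer `p` of `f` touching at `a`
lies above `q` everywhere. -/
theorem quadratic_majorizer_two_touchpoints_sharp
    (f : ℝ → ℝ) (hf : Differentiable ℝ f) (a b : ℝ) (hab : a ≠ b)
    (α₁ β₁ γ₁ α₂ β₂ γ₂ : ℝ)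
    (hq : ∀ r, α₁ * r ^ 2 + β₁ * r + γ₁ ≥ f r)
    (hqa : α₁ * a ^ 2 + β₁ * a + γ₁ = f a)
    (hqb : α₁ * b ^ 2 + β₁ * b + γ₁ = f b)
    (hp : ∀ r, α₂ * r ^ 2 + β₂ * r + γ₂ ≥ f r)
    (hpa : α₂ * a ^ 2 + β₂ * a + γ₂ = f a) :
    ∀ r, α₂ * r ^ 2 + β₂ * r + γ₂ ≥ α₁ * r ^ 2 + β₁ * r + γ₁ := by
  intro r
  have h1 := touch_deriv_eq f a α₁ β₁ γ₁ (hf a) hq hqa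
  have h2 := touch_deriv_eq f a α₂ β₂ γ₂ (hf a) hp hpa
  have hβ : β₂ = β₁ - 2 * (α₂ - α₁) * a := by linarith
  have hγ : γ₂ = γ₁ + (α₂ - α₁) * a ^ 2 := by
    subst hβ; linarith
  have key : ∀ x, (α₂ * x ^ 2 + β₂ * x + γ₂) - (α₁ * x ^ 2 + β₁ * x + γ₁)
      = (α₂ - α₁) * (x - a) ^ 2 := by
    intro x; rw [hγ, hβ]; ring
  have hb : 0 ≤ (α₂ - α₁) * (b - a) ^ 2 := by
    rw [← key b]; linarith [hp b]
  have hpos : 0 < (b - a) ^ 2 := by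
    have : b - a ≠ 0 := sub_ne_zero.mpr hab.symm
    positivity
  have hα : 0 ≤ α₂ - α₁ := nonneg_of_mul_nonneg_left hb hpos
  have := mul_nonneg hα (sq_nonneg (r - a))
  linarith [key r]
end

section
/- Fix n ≥ 1, τ > 0, responses y₁,…,yₙ ∈ ℝ, predictor vectors x₁,…,xₙ ∈ ℝᵖ, and an anchor point β_k ∈ ℝᵖ. Let r_{ki} = yᵢ − xᵢᵀβ_k and w_{ki} = exp(−τ² r_{ki}²/2). Then for every β ∈ ℝᵖ, h(β,τ) ≤ h(β_k,τ) + (τ³/(2n))·√(2/π)·Σ_{i=1}^n w_{ki}·[(yᵢ − xᵢᵀβ)² − r_{ki}²], and equality holds at β = β_k; that is, the weighted least squares surrogate majorizes the L2E loss in β at β_k. -/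
open Real

/-- The L2E loss for linear regression:
`h(β,τ) = τ/(2√π) − (τ/n)·√(2/π)·Σᵢ exp(−τ² rᵢ²/2)` with residual `rᵢ = yᵢ − xᵢᵀβ`. -/
noncomputable def L2ELoss {n p : ℕ} (y : Fin n → ℝ) (x : Fin n → Fin p → ℝ)
    (β : Fin p → ℝ) (τ : ℝ) : ℝ :=
  τ / (2 * Real.sqrt π) -
    (τ / n) * Real.sqrt (2 / π) *
      ∑ i, Real.exp (-(τ ^ 2 * (y i - ∑ j, x i j * β j) ^ 2) / 2)

/-- The weighted least squares surrogate majorizes the L2E loss in `β` at the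
anchor point `β_k`, with equality at `β = β_k`. -/
theorem l2e_weighted_ls_majorization {n p : ℕ} (hn : 1 ≤ n) (τ : ℝ) (hτ : 0 < τ)
    (y : Fin n → ℝ) (x : Fin n → Fin p → ℝ) (βk : Fin p → ℝ)
    (rk : Fin n → ℝ) (hrk : ∀ i, rk i = y i - ∑ j, x i j * βk j)
    (w : Fin n → ℝ) (hw : ∀ i, w i = Real.exp (-(τ ^ 2 * rk i ^ 2) / 2)) :
    (∀ β : Fin p → ℝ,
      L2ELoss y x β τ ≤
        L2ELoss y x βk τ +
          (τ ^ 3 / (2 * n)) * Real.sqrt (2 / π) *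
            ∑ i, w i * ((y i - ∑ j, x i j * β j) ^ 2 - rk i ^ 2)) ∧
    L2ELoss y x βk τ =
      L2ELoss y x βk τ +
        (τ ^ 3 / (2 * n)) * Real.sqrt (2 / π) *
          ∑ i, w i * ((y i - ∑ j, x i j * βk j) ^ 2 - rk i ^ 2) := by
  constructor
  · intro β
    have hS : ∑ i, w i - τ ^ 2 / 2 * ∑ i, w i * ((y i - ∑ j, x i j * β j) ^ 2 - rk i ^ 2)
        ≤ ∑ i, Real.exp (-(τ ^ 2 * (y i - ∑ j, x i j * β j) ^ 2) / 2) := by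
      rw [Finset.mul_sum, ← Finset.sum_sub_distrib]
      apply Finset.sum_le_sum
      intro i _
      generalize y i - ∑ j, x i j * β j = r
      have h1 := Real.add_one_le_exp (-(τ ^ 2 * r ^ 2) / 2 - -(τ ^ 2 * rk i ^ 2) / 2)
      have h2 := mul_le_mul_of_nonneg_left h1 (Real.exp_pos (-(τ ^ 2 * rk i ^ 2) / 2)).le
      rw [← Real.exp_add, add_sub_cancel, ← hw i] at h2
      linarith
    have hk : ∑ i, Real.exp (-(τ ^ 2 * (y i - ∑ j, x i j * βk j) ^ 2) / 2) = ∑ i, w i :=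
      Finset.sum_congr rfl fun i _ => by rw [hw, hrk]
    have hc : 0 ≤ τ / n * Real.sqrt (2 / π) := by positivity
    have h3 := mul_le_mul_of_nonneg_left hS hc
    have hcoef : τ ^ 3 / (2 * n) * Real.sqrt (2 / π)
        = τ / n * Real.sqrt (2 / π) * (τ ^ 2 / 2) := by
      field_simp
    unfold L2ELoss
    rw [hk, hcoef]
    linarith
  · have h0 : ∑ i, w i * ((y i - ∑ j, x i j * βk j) ^ 2 - rk i ^ 2) = 0 :=
      Finset.sum_eq_zero fun i _ => by rw [hrk, sub_self, mul_zero]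
    rw [h0, mul_zero, add_zero]
end

section
/- Fix n ≥ 1, τ > 0, responses y₁,…,yₙ ∈ ℝ, predictor vectors x₁,…,xₙ ∈ ℝᵖ, and a current iterate β_k ∈ ℝᵖ. Let r_{ki} = yᵢ − xᵢᵀβ_k and w_{ki} = exp(−τ² r_{ki}²/2). If β′ ∈ ℝᵖ satisfies Σ_{i=1}^n w_{ki}·(yᵢ − xᵢᵀβ′)² ≤ Σ_{i=1}^n w_{ki}·r_{ki}², then h(β′,τ) ≤ h(β_k,τ); that is, any update reducing the weighted sum of squared residuals reduces the L2E loss. -/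
open Real

/-- Any update `β'` reducing the weighted sum of squared residuals reduces the L2E loss. -/
theorem l2e_descent_of_weighted_ls_descent {n p : ℕ} (hn : 1 ≤ n) (τ : ℝ) (hτ : 0 < τ)
    (y : Fin n → ℝ) (x : Fin n → Fin p → ℝ) (βk : Fin p → ℝ)
    (rk : Fin n → ℝ) (hrk : ∀ i, rk i = y i - ∑ j, x i j * βk j)
    (w : Fin n → ℝ) (hw : ∀ i, w i = Real.exp (-(τ ^ 2 * rk i ^ 2) / 2))
    (β' : Fin p → ℝ)
    (hdec : ∑ i, w i * (y i - ∑ j, x i j * β' j) ^ 2 ≤ ∑ i, w i * rk i ^ 2) :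
    L2ELoss y x β' τ ≤ L2ELoss y x βk τ := by
  have key : ∑ i, Real.exp (-(τ ^ 2 * (y i - ∑ j, x i j * βk j) ^ 2) / 2) ≤
      ∑ i, Real.exp (-(τ ^ 2 * (y i - ∑ j, x i j * β' j) ^ 2) / 2) := by
    have h1 : ∀ i, w i + τ ^ 2 / 2 * (w i * rk i ^ 2 - w i * (y i - ∑ j, x i j * β' j) ^ 2) ≤
        Real.exp (-(τ ^ 2 * (y i - ∑ j, x i j * β' j) ^ 2) / 2) := by
      intro i
      have hpos : 0 < w i := by rw [hw]; exact Real.exp_pos _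
      have hexp : Real.exp (-(τ ^ 2 * (y i - ∑ j, x i j * β' j) ^ 2) / 2) =
          w i * Real.exp (τ ^ 2 / 2 * (rk i ^ 2 - (y i - ∑ j, x i j * β' j) ^ 2)) := by
        rw [hw, ← Real.exp_add]
        congr 1
        ring
      rw [hexp]
      have h2 := mul_le_mul_of_nonneg_left
        (Real.add_one_le_exp (τ ^ 2 / 2 * (rk i ^ 2 - (y i - ∑ j, x i j * β' j) ^ 2))) hpos.le
      linarith
    have h3 := Finset.sum_le_sum (fun i (_ : i ∈ Finset.univ) => h1 i)
    rw [Finset.sum_add_distrib, ← Finset.mul_sum, Finset.sum_sub_distrib] at h3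
    have h4 : ∑ i, Real.exp (-(τ ^ 2 * (y i - ∑ j, x i j * βk j) ^ 2) / 2) = ∑ i, w i :=
      Finset.sum_congr rfl (fun i _ => by rw [hw, hrk])
    have h5 := mul_nonneg (by positivity : 0 ≤ τ ^ 2 / 2) (sub_nonneg.mpr hdec)
    rw [h4]
    linarith
  unfold L2ELoss
  have hc : 0 ≤ (τ / n) * Real.sqrt (2 / π) := by positivity
  have := mul_le_mul_of_nonneg_left key hc
  linarith
end

section
/- Fix n ≥ 1, τ > 0, responses y₁,…,yₙ ∈ ℝ, predictor vectors x₁,…,xₙ ∈ ℝᵖ, a current iterate β_k ∈ ℝᵖ, and a penalty function ψ : ℝᵖ → ℝ. Let r_{ki} = yᵢ − xᵢᵀβ_k and w_{ki} = exp(−τ² r_{ki}²/2). If β′ ∈ ℝᵖ satisfies (τ³/(2n))·√(2/π)·Σ_{i=1}^n w_{ki}·(yᵢ − xᵢᵀβ′)² + ψ(β′) ≤ (τ³/(2n))·√(2/π)·Σ_{i=1}^n w_{ki}·r_{ki}² + ψ(β_k) — in particular, if β′ minimizes β ↦ (τ³/(2n))·√(2/π)·Σ_{i=1}^n w_{ki}·(yᵢ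 − xᵢᵀβ)² + ψ(β) — then h(β′,τ) + ψ(β′) ≤ h(β_k,τ) + ψ(β_k). -/
open Real

/-- Any update `β'` reducing the penalized weighted least squares surrogate reduces
the penalized L2E objective. -/
theorem penalized_l2e_descent {n p : ℕ} (hn : 1 ≤ n) (τ : ℝ) (hτ : 0 < τ)
    (y : Fin n → ℝ) (x : Fin n → Fin p → ℝ) (βk : Fin p → ℝ)
    (ψ : (Fin p → ℝ) → ℝ)
    (rk : Fin n → ℝ) (hrk : ∀ i, rk i = y i - ∑ j, x i j * βk j)
    (w : Fin n → ℝ) (hw : ∀ i, w i = Real.exp (-(τ ^ 2 * rk i ^ 2) / 2))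
    (β' : Fin p → ℝ)
    (hdec : (τ ^ 3 / (2 * n)) * Real.sqrt (2 / π) *
              (∑ i, w i * (y i - ∑ j, x i j * β' j) ^ 2) + ψ β' ≤
            (τ ^ 3 / (2 * n)) * Real.sqrt (2 / π) *
              (∑ i, w i * rk i ^ 2) + ψ βk) :
    L2ELoss y x β' τ + ψ β' ≤ L2ELoss y x βk τ + ψ βk := by
  have hn0 : (0:ℝ) < n := by exact_mod_cast hn
  have key : ∀ i, w i - τ ^ 2 / 2 * (w i * (y i - ∑ j, x i j * β' j) ^ 2)
      + τ ^ 2 / 2 * (w i * rk i ^ 2) ≤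
      Real.exp (-(τ ^ 2 * (y i - ∑ j, x i j * β' j) ^ 2) / 2) := by
    intro i
    generalize y i - ∑ j, x i j * β' j = r
    have h1 := Real.add_one_le_exp (-(τ ^ 2 * r ^ 2) / 2 - -(τ ^ 2 * rk i ^ 2) / 2)
    have h2 : Real.exp (-(τ ^ 2 * r ^ 2) / 2) =
        w i * Real.exp (-(τ ^ 2 * r ^ 2) / 2 - -(τ ^ 2 * rk i ^ 2) / 2) := by
      rw [hw, ← Real.exp_add]
      congr 1
      ring
    have hw0 : 0 ≤ w i := by rw [hw]; exact (Real.exp_pos _).le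
    rw [h2]
    refine le_trans (le_of_eq ?_) (mul_le_mul_of_nonneg_left h1 hw0)
    ring
  have hsum := Finset.sum_le_sum (fun i (_ : i ∈ Finset.univ) => key i)
  rw [Finset.sum_add_distrib, Finset.sum_sub_distrib, ← Finset.mul_sum, ← Finset.mul_sum] at hsum
  have hk : ∑ i, Real.exp (-(τ ^ 2 * (y i - ∑ j, x i j * βk j) ^ 2) / 2) = ∑ i, w i :=
    Finset.sum_congr rfl (fun i _ => by rw [hw, hrk])
  unfold L2ELoss
  rw [hk]
  have hc : 0 ≤ τ / n * Real.sqrt (2 / π) := by positivity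
  have hm := mul_le_mul_of_nonneg_left hsum hc
  have e : τ ^ 3 / (2 * n) * Real.sqrt (2 / π) = τ / n * Real.sqrt (2 / π) * (τ ^ 2 / 2) := by
    field_simp
  rw [e] at hdec
  linarith
end

section
/- Fix n ≥ 1, responses y₁,…,yₙ ∈ ℝ, predictor vectors x₁,…,xₙ ∈ ℝᵖ, and β ∈ ℝᵖ, and let rᵢ = yᵢ − xᵢᵀβ. The function η ↦ h(β, e^η) is twice differentiable on ℝ, and its second derivative at η equals e^η/(2√π) + (4e^{3η}/n)·√(2/π)·Σ_{i=1}^n wᵢ·rᵢ² − (e^η/n)·√(2/π)·Σ_{i=1}^n wᵢ − (e^{5η}/n)·√(2/π)·Σ_{i=1}^n wᵢ·rᵢ⁴, where wᵢ = exp(−e^{2η}·rᵢ²/2). -/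
open Real

lemma l2e_aux1 (c η : ℝ) : HasDerivAt (fun η : ℝ => Real.exp η * Real.exp (-(Real.exp η ^ 2 * c ^ 2) / 2))
    ((Real.exp η - Real.exp η ^ 3 * c ^ 2) * Real.exp (-(Real.exp η ^ 2 * c ^ 2) / 2)) η := by
  have h := Real.hasDerivAt_exp η
  have h2 := ((((h.pow 2).mul_const (c ^ 2)).neg).div_const 2).exp
  refine (h.mul h2).congr_deriv ?_
  simp only [Pi.pow_apply, Pi.neg_apply]
  ring

lemma l2e_aux2 (c η : ℝ) : HasDerivAt
    (fun η : ℝ => (Real.exp η - Real.exp η ^ 3 * c ^ 2) * Real.exp (-(Real.exp η ^ 2 * c ^ 2) / 2))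
    ((Real.exp η - 4 * Real.exp η ^ 3 * c ^ 2 + Real.exp η ^ 5 * c ^ 4) *
      Real.exp (-(Real.exp η ^ 2 * c ^ 2) / 2)) η := by
  have h := Real.hasDerivAt_exp η
  have h2 := ((((h.pow 2).mul_const (c ^ 2)).neg).div_const 2).exp
  have h3 := h.sub ((h.pow 3).mul_const (c ^ 2))
  refine (h3.mul h2).congr_deriv ?_
  simp only [Pi.pow_apply, Pi.neg_apply, Pi.sub_apply]
  ring

/-- The reparameterized L2E loss `η ↦ h(β, e^η)` is twice differentiable on `ℝ` with the
stated second derivative. -/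
theorem l2e_reparam_second_derivative {n p : ℕ} (hn : 1 ≤ n)
    (y : Fin n → ℝ) (x : Fin n → Fin p → ℝ) (β : Fin p → ℝ)
    (r : Fin n → ℝ) (hr : ∀ i, r i = y i - ∑ j, x i j * β j) :
    ∀ η : ℝ,
      DifferentiableAt ℝ (fun η : ℝ => L2ELoss y x β (Real.exp η)) η ∧
      HasDerivAt (deriv (fun η : ℝ => L2ELoss y x β (Real.exp η)))
        (Real.exp η / (2 * Real.sqrt π) +
          (4 * Real.exp (3 * η) / n) * Real.sqrt (2 / π) *
            ∑ i, Real.exp (-(Real.exp (2 * η) * r i ^ 2) / 2) * r i ^ 2 -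
          (Real.exp η / n) * Real.sqrt (2 / π) *
            ∑ i, Real.exp (-(Real.exp (2 * η) * r i ^ 2) / 2) -
          (Real.exp (5 * η) / n) * Real.sqrt (2 / π) *
            ∑ i, Real.exp (-(Real.exp (2 * η) * r i ^ 2) / 2) * r i ^ 4) η := by
  have h1 : ∀ η : ℝ, HasDerivAt (fun η : ℝ => L2ELoss y x β (Real.exp η))
      (Real.exp η / (2 * Real.sqrt π) - Real.sqrt (2 / π) / n *
        ∑ i, (Real.exp η - Real.exp η ^ 3 * r i ^ 2) *
          Real.exp (-(Real.exp η ^ 2 * r i ^ 2) / 2)) η := by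
    intro η
    have e : (fun η : ℝ => L2ELoss y x β (Real.exp η)) = fun η : ℝ =>
        Real.exp η / (2 * Real.sqrt π) - Real.sqrt (2 / π) / n *
          ∑ i, Real.exp η * Real.exp (-(Real.exp η ^ 2 * r i ^ 2) / 2) := by
      funext t
      simp only [L2ELoss, ← hr, ← Finset.mul_sum]
      ring
    rw [e]
    exact ((Real.hasDerivAt_exp η).div_const _).sub
      ((HasDerivAt.fun_sum fun i _ => l2e_aux1 (r i) η).const_mul _)
  intro η
  refine ⟨(h1 η).differentiableAt, ?_⟩
  rw [funext fun t => (h1 t).deriv]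
  refine (((Real.hasDerivAt_exp η).div_const _).sub
      ((HasDerivAt.fun_sum fun i _ => l2e_aux2 (r i) η).const_mul _)).congr_deriv ?_
  have e2 : Real.exp (2 * η) = Real.exp η ^ 2 := by rw [← Real.exp_nat_mul]; norm_num
  have e3 : Real.exp (3 * η) = Real.exp η ^ 3 := by rw [← Real.exp_nat_mul]; norm_num
  have e5 : Real.exp (5 * η) = Real.exp η ^ 5 := by rw [← Real.exp_nat_mul]; norm_num
  rw [e2, e3, e5]
  have es : ∑ i, (Real.exp η - 4 * Real.exp η ^ 3 * r i ^ 2 + Real.exp η ^ 5 * r i ^ 4) *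
      Real.exp (-(Real.exp η ^ 2 * r i ^ 2) / 2) =
      Real.exp η * ∑ i, Real.exp (-(Real.exp η ^ 2 * r i ^ 2) / 2)
      - 4 * Real.exp η ^ 3 * ∑ i, Real.exp (-(Real.exp η ^ 2 * r i ^ 2) / 2) * r i ^ 2
      + Real.exp η ^ 5 * ∑ i, Real.exp (-(Real.exp η ^ 2 * r i ^ 2) / 2) * r i ^ 4 := by
    simp only [Finset.mul_sum]
    rw [← Finset.sum_sub_distrib, ← Finset.sum_add_distrib]
    refine Finset.sum_congr rfl fun i _ => ?_
    ring
  rw [es]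
  ring
end

section
/- Fix n ≥ 1, responses y₁,…,yₙ ∈ ℝ, predictor vectors x₁,…,xₙ ∈ ℝᵖ, and β ∈ ℝᵖ, and let rᵢ = yᵢ − xᵢᵀβ. For η ∈ ℝ let wᵢ = exp(−e^{2η}·rᵢ²/2) and define the approximate Hessian d(η) = e^η/(2√π) + (4e^{3η}/n)·√(2/π)·Σ_{i=1}^n wᵢ·rᵢ². Then for every η ∈ ℝ, d(η) > 0 and d(η) ≥ (d²/dη²) h(β, e^η), i.e., the approximate Hessian obtained by discarding the negative contributions is a positive upper bound on the true second derivative of the reparameterized L2E loss. -/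
open Real

/-- The approximate Hessian `d(η)`, obtained by discarding the negative contributions,
is a positive upper bound on the true second derivative of the reparameterized L2E loss. -/
theorem approx_hessian_pos_upper_bound {n p : ℕ} (hn : 1 ≤ n)
    (y : Fin n → ℝ) (x : Fin n → Fin p → ℝ) (β : Fin p → ℝ)
    (r : Fin n → ℝ) (hr : ∀ i, r i = y i - ∑ j, x i j * β j)
    (d : ℝ → ℝ)
    (hd : ∀ η, d η = Real.exp η / (2 * Real.sqrt π) +
          (4 * Real.exp (3 * η) / n) * Real.sqrt (2 / π) *
            ∑ i, Real.exp (-(Real.exp (2 * η) * r i ^ 2) / 2) * r i ^ 2) :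
    ∀ η : ℝ,
      0 < d η ∧
      deriv (deriv (fun η : ℝ => L2ELoss y x β (Real.exp η))) η ≤ d η := by
  intro η
  have hnpos : (0 : ℝ) < n := by exact_mod_cast hn
  have hpi : 0 < Real.sqrt π := Real.sqrt_pos.mpr Real.pi_pos
  refine ⟨?_, ?_⟩
  · rw [hd]
    have h2 : 0 ≤ ∑ i, Real.exp (-(Real.exp (2 * η) * r i ^ 2) / 2) * r i ^ 2 :=
      Finset.sum_nonneg fun i _ => by positivity
    positivity
  have hw : ∀ (i : Fin n) (t : ℝ),
      HasDerivAt (fun t : ℝ => Real.exp (-(Real.exp t ^ 2 * r i ^ 2) / 2))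
        (-(Real.exp t ^ 2 * r i ^ 2) * Real.exp (-(Real.exp t ^ 2 * r i ^ 2) / 2)) t := by
    intro i t
    have h := (((((Real.hasDerivAt_exp t).pow 2).mul_const (r i ^ 2)).neg).div_const 2).exp
    refine h.congr_deriv ?_
    simp
    ring
  have hE : ∀ t : ℝ, HasDerivAt Real.exp (Real.exp t) t := Real.hasDerivAt_exp
  have h1 : ∀ t : ℝ, HasDerivAt (fun t : ℝ => L2ELoss y x β (Real.exp t))
      (Real.exp t / (2 * Real.sqrt π) - (Real.sqrt (2 / π) / n) *
        ∑ i, (Real.exp t - Real.exp t ^ 3 * r i ^ 2) *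
          Real.exp (-(Real.exp t ^ 2 * r i ^ 2) / 2)) t := by
    intro t
    have hs := HasDerivAt.fun_sum (u := Finset.univ) (fun i _ => (hE t).mul (hw i t))
    have h := ((hE t).div_const (2 * Real.sqrt π)).sub (hs.const_mul (Real.sqrt (2 / π) / n))
    have hfun : (fun t : ℝ => L2ELoss y x β (Real.exp t)) = fun t : ℝ =>
        Real.exp t / (2 * Real.sqrt π) - (Real.sqrt (2 / π) / n) *
          ∑ i, Real.exp t * Real.exp (-(Real.exp t ^ 2 * r i ^ 2) / 2) := by
      funext t
      simp only [L2ELoss, ← hr, ← Finset.mul_sum]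
      ring
    rw [hfun]
    refine h.congr_deriv ?_
    congr 2
    refine Finset.sum_congr rfl fun i _ => ?_
    ring
  have h2 : HasDerivAt (deriv (fun t : ℝ => L2ELoss y x β (Real.exp t)))
      (Real.exp η / (2 * Real.sqrt π) - (Real.sqrt (2 / π) / n) *
        ∑ i, (Real.exp η - 4 * Real.exp η ^ 3 * r i ^ 2 + Real.exp η ^ 5 * r i ^ 4) *
          Real.exp (-(Real.exp η ^ 2 * r i ^ 2) / 2)) η := by
    rw [show deriv (fun t : ℝ => L2ELoss y x β (Real.exp t)) = _ from
      funext fun t => (h1 t).deriv]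
    have hs := HasDerivAt.fun_sum (u := Finset.univ) (fun i _ =>
      ((hE η).sub (((hE η).pow 3).mul_const (r i ^ 2))).mul (hw i η))
    have h := ((hE η).div_const (2 * Real.sqrt π)).sub (hs.const_mul (Real.sqrt (2 / π) / n))
    refine h.congr_deriv ?_
    congr 2
    refine Finset.sum_congr rfl fun i _ => ?_
    simp
    ring
  rw [h2.deriv, hd]
  have e2 : Real.exp (2 * η) = Real.exp η ^ 2 := by
    rw [← Real.exp_nat_mul]; norm_num
  have e3 : Real.exp (3 * η) = Real.exp η ^ 3 := by
    rw [← Real.exp_nat_mul]; norm_num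
  rw [e2, e3]
  have key : -(4 * Real.exp η ^ 3 *
        ∑ i, Real.exp (-(Real.exp η ^ 2 * r i ^ 2) / 2) * r i ^ 2) ≤
      ∑ i, (Real.exp η - 4 * Real.exp η ^ 3 * r i ^ 2 + Real.exp η ^ 5 * r i ^ 4) *
          Real.exp (-(Real.exp η ^ 2 * r i ^ 2) / 2) := by
    rw [Finset.mul_sum, ← Finset.sum_neg_distrib]
    refine Finset.sum_le_sum fun i _ => ?_
    have : 0 ≤ (Real.exp η + Real.exp η ^ 5 * r i ^ 4) *
      Real.exp (-(Real.exp η ^ 2 * r i ^ 2) / 2) := by positivity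
    linarith
  have hC : 0 ≤ Real.sqrt (2 / π) / n := by positivity
  have := mul_le_mul_of_nonneg_left key hC
  have e : (4 * Real.exp η ^ 3 / n) * Real.sqrt (2 / π) *
      ∑ i, Real.exp (-(Real.exp η ^ 2 * r i ^ 2) / 2) * r i ^ 2 =
      (Real.sqrt (2 / π) / n) * (4 * Real.exp η ^ 3 *
        ∑ i, Real.exp (-(Real.exp η ^ 2 * r i ^ 2) / 2) * r i ^ 2) := by ring
  rw [e]
  linarith
end

section
/- Fix n ≥ 1, responses y₁,…,yₙ ∈ ℝ, predictor vectors x₁,…,xₙ ∈ ℝᵖ, and β ∈ ℝᵖ, and let rᵢ = yᵢ − xᵢᵀβ. Let φ(η) = h(β, e^η), fix η₀ ∈ ℝ, let g = φ′(η₀), let wᵢ = exp(−e^{2η₀}·rᵢ²/2), and let d = e^{η₀}/(2√π) + (4e^{3η₀}/n)·√(2/π)·Σ_{i=1}^n wᵢ·rᵢ². If g ≠ 0, then there exists t̄ > 0 such that for every stepsize t with 0 < t < t̄, φ(η₀ − t·g/d) < φ(η₀); that is, the modified Newton increment −d⁻¹·φ′(η₀) is a descent direction for the reparameterized L2E loss.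 -/
open Real

/-- If the gradient is nonzero, the modified Newton increment `−d⁻¹·φ′(η₀)` is a descent
direction: sufficiently small steps strictly decrease the reparameterized L2E loss. -/
theorem modified_newton_descent_direction {n p : ℕ} (hn : 1 ≤ n)
    (y : Fin n → ℝ) (x : Fin n → Fin p → ℝ) (β : Fin p → ℝ)
    (r : Fin n → ℝ) (hr : ∀ i, r i = y i - ∑ j, x i j * β j)
    (φ : ℝ → ℝ) (hφ : ∀ η, φ η = L2ELoss y x β (Real.exp η))
    (η₀ : ℝ) (g : ℝ) (hg : g = deriv φ η₀)
    (w : Fin n → ℝ) (hw : ∀ i, w i = Real.exp (-(Real.exp (2 * η₀) * r i ^ 2) / 2))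
    (d : ℝ)
    (hd : d = Real.exp η₀ / (2 * Real.sqrt π) +
          (4 * Real.exp (3 * η₀) / n) * Real.sqrt (2 / π) * ∑ i, w i * r i ^ 2)
    (hg0 : g ≠ 0) :
    ∃ tbar > 0, ∀ t : ℝ, 0 < t → t < tbar → φ (η₀ - t * g / d) < φ η₀ := by
  have hd0 : 0 < d := by
    rw [hd]
    have h1 : 0 ≤ ∑ i, w i * r i ^ 2 :=
      Finset.sum_nonneg fun i _ => by rw [hw i]; positivity
    have h2 : 0 < Real.exp η₀ / (2 * Real.sqrt π) := by
      have := Real.pi_pos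
      positivity
    have h3 : 0 ≤ (4 * Real.exp (3 * η₀) / n) * Real.sqrt (2 / π) := by positivity
    have := mul_nonneg h3 h1
    linarith
  have hdiff : HasDerivAt φ g η₀ := by
    rw [hg]
    exact (differentiableAt_of_deriv_ne_zero (hg ▸ hg0)).hasDerivAt
  have hlin : HasDerivAt (fun t : ℝ => η₀ - t * g / d) (-(1 * g / d)) 0 :=
    (((hasDerivAt_id (0 : ℝ)).mul_const g).div_const d).const_sub η₀
  have hcomp : HasDerivAt (fun t : ℝ => φ (η₀ - t * g / d)) (g * (-(1 * g / d))) 0 := by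
    refine HasDerivAt.comp (0 : ℝ) (h₂ := φ) ?_ hlin
    simpa using hdiff
  have hneg : g * (-(1 * g / d)) < 0 := by
    have : 0 < g ^ 2 / d := by positivity
    have e : g * (-(1 * g / d)) = -(g ^ 2 / d) := by ring
    linarith
  have hev := (hasDerivAt_iff_tendsto_slope.1 hcomp).eventually_lt_const hneg
  have hev2 := hev.filter_mono (nhdsGT_le_nhdsNE (0 : ℝ))
  obtain ⟨u, hu, hsub⟩ := mem_nhdsGT_iff_exists_Ioo_subset.1 hev2
  refine ⟨u, hu, fun t ht htu => ?_⟩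
  have hs := hsub ⟨ht, htu⟩
  simp only [Set.mem_setOf_eq, slope_def_field, sub_zero, zero_mul, zero_div] at hs
  have := (div_lt_iff₀ ht).1 hs
  linarith
end

section
/- Let E be a real Hilbert space and C ⊆ E a nonempty closed convex subset. For each θ ∈ E, let P_C(θ) denote the unique point of C satisfying ‖θ − P_C(θ)‖ = dist(θ, C), where dist(θ, C) = inf over β ∈ C of ‖θ − β‖. Then the function θ ↦ (1/2)·dist(θ, C)² is Fréchet differentiable at every θ ∈ E, with derivative given by the continuous linear map v ↦ ⟨θ − P_C(θ), v⟩; that is, its gradient at θ is θ − P_C(θ). -/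
open Metric

/-- For a nonempty closed convex subset `C` of a real Hilbert space, the squared
distance penalty `θ ↦ (1/2)dist(θ,C)²` is Fréchet differentiable everywhere, with
derivative `v ↦ ⟪θ − P_C(θ), v⟫`, i.e. gradient `θ − P_C(θ)`, where `P_C` is the
metric projection onto `C`. -/
theorem dist_sq_penalty_fderiv {E : Type*} [NormedAddCommGroup E]
    [InnerProductSpace ℝ E] [CompleteSpace E]
    (C : Set E) (hC : C.Nonempty) (hCc : IsClosed C) (hCconv : Convex ℝ C)
    (P : E → E)
    (hP : ∀ θ, P θ ∈ C ∧ ‖θ - P θ‖ = Metric.infDist θ C)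
    (hPuniq : ∀ θ, ∀ z ∈ C, ‖θ - z‖ = Metric.infDist θ C → z = P θ) :
    ∀ θ : E,
      HasFDerivAt (fun θ : E => (1 / 2) * Metric.infDist θ C ^ 2)
        (innerSL ℝ (θ - P θ)) θ := by
  intro θ
  have key : ∀ w ∈ C, inner ℝ (θ - P θ) (w - P θ) ≤ 0 := by
    refine (norm_eq_iInf_iff_real_inner_le_zero hCconv (hP θ).1).1 ?_
    rw [(hP θ).2, Metric.infDist_eq_iInf]
    simp only [dist_eq_norm]
  rw [hasFDerivAt_iff_isLittleO_nhds_zero]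
  have hO : (fun h : E => (1 / 2) * Metric.infDist (θ + h) C ^ 2
      - (1 / 2) * Metric.infDist θ C ^ 2 - innerSL ℝ (θ - P θ) h)
      =O[nhds 0] fun h : E => ‖h‖ ^ 2 := by
    refine Asymptotics.IsBigO.of_bound (1 / 2) (Filter.Eventually.of_forall fun h => ?_)
    have hup : Metric.infDist (θ + h) C ≤ ‖(θ - P θ) + h‖ := by
      have := Metric.infDist_le_dist_of_mem (x := θ + h) (hP θ).1
      rwa [dist_eq_norm, show θ + h - P θ = (θ - P θ) + h by abel] at this
    have hup2 : Metric.infDist (θ + h) C ^ 2 ≤ ‖(θ - P θ) + h‖ ^ 2 :=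
      pow_le_pow_left₀ Metric.infDist_nonneg hup 2
    rw [norm_add_sq_real] at hup2
    have hlow : Metric.infDist (θ + h) C ^ 2
        = ‖(θ - P θ) + (h - (P (θ + h) - P θ))‖ ^ 2 := by
      rw [← (hP (θ + h)).2]
      congr 2
      abel
    rw [norm_add_sq_real, inner_sub_right] at hlow
    have hk := key _ (hP (θ + h)).1
    have hn := sq_nonneg ‖h - (P (θ + h) - P θ)‖
    rw [← (hP θ).2, innerSL_apply_apply, Real.norm_eq_abs, Real.norm_eq_abs,
      abs_of_nonneg (sq_nonneg ‖h‖), abs_le]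
    constructor
    · nlinarith [sq_nonneg ‖h‖]
    · linarith
  refine hO.trans_isLittleO ?_
  exact Asymptotics.isLittleO_norm_pow_id one_lt_two
end
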